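/- The set {1, √2 cos(πx)/ω(2), √2 cos(2πx)/ω(3), …}, where ω(k) = √(1 + ((k-1)π)² + ((k-1)π)⁴), is an orthonormal basis of the Hilbert space H²_N(0,1) = {u ∈ H²(0,1) : u'(0) = u'(1) = 0} with inner product ⟨u,v⟩ = ⟨u,v⟩_{L²} + ⟨u',v'⟩_{L²} + ⟨u'',v''⟩_{L²}. -/

import Mathlib

open MeasureTheory

/-- `u` is an `H¹` function on `(0,1)` with weak derivative `u'`. -/
def IsH1 (u u' : ℝ → ℝ) : Prop :=
  ContinuousOn u (Set.Icc 0 1) ∧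
  IntervalIntegrable u' volume 0 1 ∧
  IntervalIntegrable (fun t => u' t ^ 2) volume 0 1 ∧
  ∀ x ∈ Set.Icc (0:ℝ) 1, u x = u 0 + ∫ t in (0:ℝ)..x, u' t

/-- The weights `ω(k) = √(1 + ((k-1)π)² + ((k-1)π)⁴)` (1-based index). -/
noncomputable def omegaW (k : ℕ) : ℝ :=
  Real.sqrt (1 + (((k:ℝ) - 1) * Real.pi) ^ 2 + (((k:ℝ) - 1) * Real.pi) ^ 4)

/-- The candidate basis of `H²_N(0,1)` (1-based index):
`E 1 = 1` and `E k = √2 cos((k-1)πx)/ω(k)` for `k ≥ 2`. -/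
noncomputable def EFun (k : ℕ) (x : ℝ) : ℝ :=
  if k = 1 then 1
  else Real.sqrt 2 * Real.cos (((k:ℝ) - 1) * Real.pi * x) / omegaW k

/-- The `H²(0,1)` inner product of explicit smooth functions `f`, `g`. -/
noncomputable def H2inner (f g : ℝ → ℝ) : ℝ :=
  (∫ x in (0:ℝ)..1, f x * g x) + (∫ x in (0:ℝ)..1, deriv f x * deriv g x) +
    ∫ x in (0:ℝ)..1, deriv (deriv f) x * deriv (deriv g) x

/-- The `H²` inner product of an `H²` function `u` (with weak derivatives `u'`, `u''`)
with an explicit smooth function `g`. -/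
noncomputable def H2innerWith (u u' u'' : ℝ → ℝ) (g : ℝ → ℝ) : ℝ :=
  (∫ x in (0:ℝ)..1, u x * g x) + (∫ x in (0:ℝ)..1, u' x * deriv g x) +
    ∫ x in (0:ℝ)..1, u'' x * deriv (deriv g) x

open scoped Real

/-- Functions with a continuous derivative are `H¹`. -/
lemma IsH1.of_hasDerivAt {f f' : ℝ → ℝ} (h : ∀ x, HasDerivAt f (f' x) x) (hf' : Continuous f') :
    IsH1 f f' := by
  refine ⟨fun x _ ↦ (h x).continuousAt.continuousWithinAt, hf'.intervalIntegrable _ _,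
    (hf'.pow 2).intervalIntegrable _ _, fun x _ ↦ ?_⟩
  rw [intervalIntegral.integral_eq_sub_of_hasDerivAt (fun y _ ↦ h y) (hf'.intervalIntegrable _ _)]
  ring

lemma IsH1.intervalIntegrable {u u' : ℝ → ℝ} (h : IsH1 u u') : IntervalIntegrable u volume 0 1 :=
  ContinuousOn.intervalIntegrable (by simpa using h.1)

lemma IsH1.intervalIntegrable_sq {u u' : ℝ → ℝ} (h : IsH1 u u') :
    IntervalIntegrable (fun x ↦ u x ^ 2) volume 0 1 :=
  ContinuousOn.intervalIntegrable (by simpa using! h.1.pow 2)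

/-- An `H¹` function agrees on `[0,1]` with an absolutely continuous function whose derivative
is the given weak derivative almost everywhere. -/
lemma IsH1.exists_absolutelyContinuousOnInterval {u u' : ℝ → ℝ} (h : IsH1 u u') :
    ∃ U : ℝ → ℝ, AbsolutelyContinuousOnInterval U 0 1 ∧ (∀ x ∈ Set.Icc (0 : ℝ) 1, u x = U x) ∧
      ∀ᵐ x, x ∈ Set.Icc (0 : ℝ) 1 → deriv U x = u' x := by
  refine ⟨fun x ↦ u 0 + ∫ t in (0:ℝ)..x, u' t, ?_, h.2.2.2, ?_⟩
  · exact (contDiff_const (c := u 0)).contDiffOn.absolutelyContinuousOnInterval.fun_add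
      (h.2.1.absolutelyContinuousOnInterval_intervalIntegral (by simp))
  · filter_upwards [h.2.1.ae_hasDerivAt_integral] with x hx hx'
    exact ((hx (by simpa using hx') 0 (by simp)).const_add (u 0)).deriv

/-- Integration by parts for `H¹` functions. -/
lemma IsH1.integral_mul_add_integral_mul {u u' v v' : ℝ → ℝ} (hu : IsH1 u u') (hv : IsH1 v v') :
    (∫ x in (0:ℝ)..1, u' x * v x) + (∫ x in (0:ℝ)..1, u x * v' x) = u 1 * v 1 - u 0 * v 0 := by
  obtain ⟨U, hU, huU, hU'⟩ := hu.exists_absolutelyContinuousOnInterval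
  obtain ⟨V, hV, hvV, hV'⟩ := hv.exists_absolutelyContinuousOnInterval
  rw [huU 1 (by simp), huU 0 (by simp), hvV 1 (by simp), hvV 0 (by simp),
    ← hU.integral_deriv_mul_eq_sub hV, ← intervalIntegral.integral_add
      (hu.2.1.mul_continuousOn (by simpa using hv.1))
      (hv.2.1.continuousOn_mul (by simpa using hu.1))]
  apply intervalIntegral.integral_congr_ae
  filter_upwards [hU', hV'] with x hxU hxV hx
  have hx : x ∈ Set.Icc (0 : ℝ) 1 :=
    Set.Ioc_subset_Icc_self (by simpa [Set.uIoc_of_le zero_le_one] using hx)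
  rw [hxU hx, hxV hx, huU x hx, hvV x hx]

lemma hasDerivAt_const_mul_cos (c a x : ℝ) :
    HasDerivAt (fun x ↦ c * Real.cos (a * x)) (-(c * a) * Real.sin (a * x)) x := by
  convert! (((hasDerivAt_id x).const_mul a).cos.const_mul c) using 1
  simp; ring

lemma hasDerivAt_const_mul_sin (c a x : ℝ) :
    HasDerivAt (fun x ↦ c * Real.sin (a * x)) (c * a * Real.cos (a * x)) x := by
  convert! (((hasDerivAt_id x).const_mul a).sin.const_mul c) using 1
  simp; ring

/-! ### Parseval's identity for cosine series -/

lemma IntervalIntegrable.comp_abs {g : ℝ → ℝ} (hg : IntervalIntegrable g volume 0 1) :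
    IntervalIntegrable (fun x ↦ g |x|) volume (-1) 1 := by
  have hpos : IntervalIntegrable (fun x ↦ g |x|) volume 0 1 := by
    refine hg.congr fun x hx ↦ ?_
    rw [Set.uIoc_of_le zero_le_one] at hx
    simp [abs_of_pos hx.1]
  have hneg : IntervalIntegrable (fun x ↦ g |x|) volume (-1) 0 := by
    rw [IntervalIntegrable.iff_comp_neg]
    simpa using hpos.symm
  exact hneg.trans hpos

lemma integral_neg_one_one {h : ℝ → ℂ} (hh : IntervalIntegrable h volume (-1) 1) :
    ∫ x in (-1:ℝ)..1, h x = ∫ x in (0:ℝ)..1, (h x + h (-x)) := by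
  have hneg : IntervalIntegrable h volume (-1) 0 :=
    hh.mono_set (by
      rw [Set.uIcc_of_le (by norm_num), Set.uIcc_of_le (by norm_num)]
      exact Set.Icc_subset_Icc_right zero_le_one)
  have hpos : IntervalIntegrable h volume 0 1 :=
    hh.mono_set (by
      rw [Set.uIcc_of_le (by norm_num), Set.uIcc_of_le (by norm_num)]
      exact Set.Icc_subset_Icc_left (by norm_num))
  have hneg' : IntervalIntegrable (fun x ↦ h (-x)) volume 0 1 := by
    rw [IntervalIntegrable.iff_comp_neg]
    simpa using hneg.symm
  rw [← intervalIntegral.integral_add_adjacent_intervals hneg hpos,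
    intervalIntegral.integral_add hpos hneg', add_comm]
  simp

/-- The number of exponentials contributing to the `n`-th cosine mode. -/
def cosMult (n : ℕ) : ℝ := if n = 0 then 1 else 2

/-- The cosine coefficients of a function on `(0,1)`. -/
noncomputable def cosCoeff (f : ℝ → ℝ) (n : ℕ) : ℝ :=
  ∫ x in (0:ℝ)..1, f x * Real.cos (n * π * x)

lemma fourierCoeffOn_comp_abs {f : ℝ → ℝ} (hf : IntervalIntegrable f volume 0 1) (n : ℤ) :
    fourierCoeffOn (by norm_num : (-1:ℝ) < 1) (fun x ↦ (f |x| : ℂ)) n =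
      (cosCoeff f n.natAbs : ℂ) := by
  have hF : IntervalIntegrable (fun x ↦ (f |x| : ℂ)) volume (-1) 1 := by
    have := hf.comp_abs
    exact ⟨this.1.ofReal, this.2.ofReal⟩
  rw [fourierCoeffOn_eq_integral, integral_neg_one_one, cosCoeff,
    ← intervalIntegral.integral_ofReal, ← intervalIntegral.integral_smul]
  · refine intervalIntegral.integral_congr fun x hx ↦ ?_
    rw [Set.uIcc_of_le zero_le_one] at hx
    have hcos : Real.cos ((n.natAbs : ℝ) * π * x) = Real.cos (n * π * x) := by
      rw [Nat.cast_natAbs, Int.cast_abs]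
      rcases abs_choice (n : ℝ) with h | h
      · rw [h]
      · rw [h, neg_mul, neg_mul, Real.cos_neg]
    simp only [hcos, abs_neg, abs_of_nonneg hx.1, fourier_coe_apply]
    push_cast
    rw [Complex.cos]
    have h1 : 2 * (π : ℂ) * Complex.I * (-n) * x / (1 - -1) = -(n * π * x) * Complex.I := by ring
    have h2 : 2 * (π : ℂ) * Complex.I * (-n) * -x / (1 - -1) = n * π * x * Complex.I := by ring
    rw [h1, h2]
    simp only [Complex.real_smul, smul_eq_mul]
    push_cast
    ring
  · refine hF.continuousOn_mul (Continuous.continuousOn ?_)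
    exact (map_continuous (fourier (-n))).comp (AddCircle.continuous_mk' _)

lemma hasSum_cosCoeff_sq {f : ℝ → ℝ} (hf : IntervalIntegrable f volume 0 1)
    (hf2 : IntervalIntegrable (fun x ↦ f x ^ 2) volume 0 1) :
    HasSum (fun n : ℕ ↦ cosMult n * cosCoeff f n ^ 2) (∫ x in (0:ℝ)..1, f x ^ 2) := by
  have hsq := hf2.comp_abs
  have hL2 : MemLp (fun x ↦ (f |x| : ℂ)) 2 (volume.restrict (Set.Ioc (-1) 1)) := by
    have hm : AEStronglyMeasurable (fun x ↦ (f |x| : ℂ)) (volume.restrict (Set.Ioc (-1) 1)) :=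
      hf.comp_abs.1.ofReal.1
    rw [memLp_two_iff_integrable_sq_norm hm]
    simpa [IntegrableOn] using hsq.1
  have hS := (hasSum_sq_fourierCoeffOn (by norm_num : (-1:ℝ) < 1) hL2).nat_add_neg
  have hsq_ofReal : IntervalIntegrable (fun x ↦ ((f |x| ^ 2 : ℝ) : ℂ)) volume (-1) 1 :=
    ⟨Integrable.ofReal hsq.1, Integrable.ofReal hsq.2⟩
  have hI : ∫ x in (-1:ℝ)..1, ‖(f |x| : ℂ)‖ ^ 2 = 2 * ∫ x in (0:ℝ)..1, f x ^ 2 := by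
    have := integral_neg_one_one (h := fun x ↦ ((f |x| ^ 2 : ℝ) : ℂ)) hsq_ofReal
    simp only [abs_neg, ← Complex.ofReal_add, intervalIntegral.integral_ofReal,
      Complex.ofReal_inj] at this
    simp only [Complex.norm_real, Real.norm_eq_abs, sq_abs]
    rw [this, ← intervalIntegral.integral_const_mul]
    refine intervalIntegral.integral_congr fun x hx ↦ ?_
    rw [Set.uIcc_of_le zero_le_one] at hx
    simp only [abs_of_nonneg hx.1]
    ring
  rw [hI] at hS
  simp only [fourierCoeffOn_comp_abs hf, Complex.norm_real, Real.norm_eq_abs, sq_abs,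
    Int.natAbs_neg, Int.natAbs_natCast, Int.natAbs_zero] at hS
  convert! hS.sub (hasSum_ite_eq 0 (cosCoeff f 0 ^ 2)) using 1
  · funext n
    rcases eq_or_ne n 0 with rfl | hn
    · simp [cosMult]
    · simp [cosMult, hn]
      ring
  · simp only [smul_eq_mul]
    ring

/-- The polarized form of Parseval's identity for cosine series. -/
lemma hasSum_cosCoeff_mul {f g : ℝ → ℝ} (hf : IntervalIntegrable f volume 0 1)
    (hf2 : IntervalIntegrable (fun x ↦ f x ^ 2) volume 0 1)
    (hg : IntervalIntegrable g volume 0 1)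
    (hg2 : IntervalIntegrable (fun x ↦ g x ^ 2) volume 0 1)
    (hfg : IntervalIntegrable (fun x ↦ f x * g x) volume 0 1) :
    HasSum (fun n : ℕ ↦ cosMult n * (cosCoeff f n * cosCoeff g n))
      (∫ x in (0:ℝ)..1, f x * g x) := by
  have hsq : (fun x ↦ (f x + g x) ^ 2) = fun x ↦ f x ^ 2 + g x ^ 2 + 2 * (f x * g x) := by
    funext x
    ring
  have hadd : IntervalIntegrable (fun x ↦ (f x + g x) ^ 2) volume 0 1 := by
    rw [hsq]
    exact (hf2.add hg2).add (hfg.const_mul 2)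
  have hc (n : ℕ) : cosCoeff (fun x ↦ f x + g x) n = cosCoeff f n + cosCoeff g n := by
    have hcont : ContinuousOn (fun x : ℝ ↦ Real.cos (n * π * x)) (Set.uIcc 0 1) := by fun_prop
    simp only [cosCoeff, add_mul]
    exact intervalIntegral.integral_add (hf.mul_continuousOn hcont) (hg.mul_continuousOn hcont)
  convert! ((((hasSum_cosCoeff_sq (hf.add hg) hadd).sub (hasSum_cosCoeff_sq hf hf2)).sub
    (hasSum_cosCoeff_sq hg hg2)).div_const 2) using 1
  · funext n
    rw [hc]
    ring
  · rw [hsq, intervalIntegral.integral_add (hf2.add hg2) (hfg.const_mul 2),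
      intervalIntegral.integral_add hf2 hg2, intervalIntegral.integral_const_mul]
    ring

/-! ### The basis functions -/

/-- The normalizing factor of the `n`-th basis function (0-based index). -/
noncomputable def basisCoeff (n : ℕ) : ℝ := if n = 0 then 1 else √2 / omegaW (n + 1)

lemma omegaW_succ_sq (n : ℕ) : omegaW (n + 1) ^ 2 = 1 + (n * π) ^ 2 + (n * π) ^ 4 := by
  rw [omegaW, Real.sq_sqrt (by positivity)]
  simp

lemma basisCoeff_sq_mul (n : ℕ) :
    basisCoeff n ^ 2 * (1 + (n * π) ^ 2 + (n * π) ^ 4) = cosMult n := by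
  rcases eq_or_ne n 0 with rfl | hn
  · simp [basisCoeff, cosMult]
  · have h : (1 + (n * π) ^ 2 + (n * π) ^ 4 : ℝ) ≠ 0 := by positivity
    simp only [basisCoeff, hn, if_false, cosMult]
    rw [div_pow, omegaW_succ_sq, Real.sq_sqrt zero_le_two, div_mul_cancel₀ _ h]

lemma EFun_succ (n : ℕ) : EFun (n + 1) = fun x ↦ basisCoeff n * Real.cos (n * π * x) := by
  funext x
  rcases eq_or_ne n 0 with rfl | hn
  · simp [EFun, basisCoeff]
  · simp only [EFun, basisCoeff, hn, Nat.add_eq_right, if_false]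
    push_cast
    rw [add_sub_cancel_right]
    ring

lemma deriv_EFun_succ (n : ℕ) :
    deriv (EFun (n + 1)) = fun x ↦ -(basisCoeff n * (n * π)) * Real.sin (n * π * x) := by
  rw [EFun_succ]
  exact funext fun x ↦ (hasDerivAt_const_mul_cos _ _ x).deriv

lemma deriv_deriv_EFun_succ (n : ℕ) :
    deriv (deriv (EFun (n + 1))) =
      fun x ↦ -(basisCoeff n * (n * π)) * (n * π) * Real.cos (n * π * x) := by
  rw [deriv_EFun_succ]
  exact funext fun x ↦ (hasDerivAt_const_mul_sin _ _ x).deriv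

lemma cosCoeff_weak_deriv_two {u u' u'' : ℝ → ℝ} (hu : IsH1 u u') (hu' : IsH1 u' u'')
    (h0 : u' 0 = 0) (h1 : u' 1 = 0) (n : ℕ) :
    (∫ x in (0:ℝ)..1, u' x * Real.sin (n * π * x)) = -(n * π) * cosCoeff u n ∧
      cosCoeff u'' n = -(n * π) ^ 2 * cosCoeff u n := by
  have hs := hu.integral_mul_add_integral_mul (IsH1.of_hasDerivAt
    (hasDerivAt_const_mul_sin 1 (n * π)) (by fun_prop))
  have hc := hu'.integral_mul_add_integral_mul (IsH1.of_hasDerivAt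
    (hasDerivAt_const_mul_cos 1 (n * π)) (by fun_prop))
  simp only [one_mul, mul_one, mul_zero, Real.sin_zero, Real.sin_nat_mul_pi, sub_zero,
    mul_left_comm (u _), intervalIntegral.integral_const_mul] at hs
  simp only [one_mul, h0, h1, zero_mul, sub_zero,
    mul_left_comm (u' _), intervalIntegral.integral_const_mul] at hc
  simp only [cosCoeff]
  have hs' := eq_neg_of_add_eq_zero_left hs
  refine ⟨by rw [hs']; ring, ?_⟩
  rw [hs'] at hc
  linear_combination hc

lemma H2innerWith_EFun_succ {u u' u'' : ℝ → ℝ} (hu : IsH1 u u') (hu' : IsH1 u' u'')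
    (h0 : u' 0 = 0) (h1 : u' 1 = 0) (n : ℕ) :
    H2innerWith u u' u'' (EFun (n + 1)) =
      basisCoeff n * (1 + (n * π) ^ 2 + (n * π) ^ 4) * cosCoeff u n := by
  obtain ⟨hs, hc⟩ := cosCoeff_weak_deriv_two hu hu' h0 h1 n
  rw [H2innerWith, deriv_deriv_EFun_succ, deriv_EFun_succ, EFun_succ]
  simp only [mul_left_comm (u _), mul_left_comm (u' _), mul_left_comm (u'' _),
    intervalIntegral.integral_const_mul, hs]
  change _ * cosCoeff u n + _ + _ * cosCoeff u'' n = _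
  rw [hc]
  ring

lemma integral_cos_int_mul_pi (k : ℤ) :
    ∫ x in (0:ℝ)..1, Real.cos (k * π * x) = if k = 0 then 1 else 0 := by
  rcases eq_or_ne k 0 with rfl | hk
  · simp
  · have hk' : (k * π : ℝ) ≠ 0 := mul_ne_zero (by exact_mod_cast hk) Real.pi_ne_zero
    simp [hk, intervalIntegral.integral_comp_mul_left _ hk', Real.sin_int_mul_pi]

lemma cosCoeff_cos (m n : ℕ) :
    cosMult n * cosCoeff (fun x ↦ Real.cos (m * π * x)) n = if m = n then 1 else 0 := by
  have hprod (x : ℝ) : Real.cos (m * π * x) * Real.cos (n * π * x) =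
      (Real.cos (((m - n : ℤ) : ℝ) * π * x) + Real.cos (((m + n : ℤ) : ℝ) * π * x)) / 2 := by
    push_cast
    rw [sub_mul, sub_mul, add_mul, add_mul, Real.cos_sub, Real.cos_add]
    ring
  simp only [cosCoeff, hprod]
  rw [intervalIntegral.integral_div, intervalIntegral.integral_add
    (Continuous.intervalIntegrable (by fun_prop) _ _)
    (Continuous.intervalIntegrable (by fun_prop) _ _),
    integral_cos_int_mul_pi, integral_cos_int_mul_pi]
  unfold cosMult
  split_ifs <;> first | omega | norm_num

lemma H2inner_EFun_succ (m n : ℕ) :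
    H2inner (EFun (m + 1)) (EFun (n + 1)) = if m = n then 1 else 0 := by
  have hE : IsH1 (EFun (m + 1)) (deriv (EFun (m + 1))) := by
    rw [deriv_EFun_succ, EFun_succ]
    exact .of_hasDerivAt (hasDerivAt_const_mul_cos _ _) (by fun_prop)
  have hE' : IsH1 (deriv (EFun (m + 1))) (deriv (deriv (EFun (m + 1)))) := by
    rw [deriv_deriv_EFun_succ, deriv_EFun_succ]
    exact .of_hasDerivAt (hasDerivAt_const_mul_sin _ _) (by fun_prop)
  have hcoeff : cosCoeff (EFun (m + 1)) n =
      basisCoeff m * cosCoeff (fun x ↦ Real.cos (m * π * x)) n := by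
    simp only [EFun_succ, cosCoeff, mul_assoc (basisCoeff m), intervalIntegral.integral_const_mul]
  change H2innerWith _ _ _ _ = _
  rw [H2innerWith_EFun_succ hE hE' (by simp [deriv_EFun_succ])
    (by simp [deriv_EFun_succ, Real.sin_nat_mul_pi]), hcoeff]
  have horth := cosCoeff_cos m n
  split_ifs at horth ⊢ with hmn
  · subst hmn
    rw [← basisCoeff_sq_mul] at horth
    linear_combination horth
  · have hne : cosMult n ≠ 0 := by
      unfold cosMult
      split_ifs <;> norm_num
    rw [(mul_eq_zero.mp horth).resolve_left hne]
    ring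

/-- The system `{1, √2 cos(πx)/ω(2), √2 cos(2πx)/ω(3), …}` is an orthonormal basis of
`H²_N(0,1) = {u ∈ H²(0,1) : u'(0) = u'(1) = 0}`: it lies in `H²_N`, is orthonormal for
the `H²` inner product, and Parseval's identity holds for every `u ∈ H²_N(0,1)`. -/
theorem cos_orthonormal_basis_H2N :
    (∀ j k : ℕ, 1 ≤ j → 1 ≤ k →
      H2inner (EFun j) (EFun k) = if j = k then 1 else 0) ∧
    (∀ u u' u'' : ℝ → ℝ, IsH1 u u' → IsH1 u' u'' → u' 0 = 0 → u' 1 = 0 →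
      (∫ x in (0:ℝ)..1, u x ^ 2) + (∫ x in (0:ℝ)..1, u' x ^ 2) +
          (∫ x in (0:ℝ)..1, u'' x ^ 2) =
        ∑' k : ℕ, H2innerWith u u' u'' (EFun (k + 1)) ^ 2) := by
  refine ⟨fun j k hj hk ↦ ?_, fun u u' u'' hu hu' h0 h1 ↦ ?_⟩
  · obtain ⟨m, rfl⟩ := Nat.exists_eq_add_of_le' hj
    obtain ⟨n, rfl⟩ := Nat.exists_eq_add_of_le' hk
    simp [H2inner_EFun_succ]
  · have hU := hasSum_cosCoeff_sq hu.intervalIntegrable hu.intervalIntegrable_sq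
    have hW := hasSum_cosCoeff_sq hu'.2.1 hu'.2.2.1
    have hUW := hasSum_cosCoeff_mul hu.intervalIntegrable hu.intervalIntegrable_sq hu'.2.1
      hu'.2.2.1 (hu'.2.1.continuousOn_mul (by simpa using hu.1))
    have hparts := hu.integral_mul_add_integral_mul hu'
    simp only [h0, h1, mul_zero, sub_zero, ← pow_two] at hparts
    rw [eq_neg_of_add_eq_zero_left hparts, ← sub_eq_add_neg]
    refine (((hU.sub hUW).add hW).congr_fun fun n ↦ ?_).tsum_eq.symm
    rw [H2innerWith_EFun_succ hu hu' h0 h1, (cosCoeff_weak_deriv_two hu hu' h0 h1 n).2,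
      ← basisCoeff_sq_mul]
    ring
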